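/- arXiv:2407.06777 — 3 statements merged into one kernel-verified Lean document; each statement's English description precedes it below -/
import Mathlib

section
/- Let H = (V, E) be a hypergraph of rank 3 that is a clutter, and let u, v ∈ V be vertices such that u-F_{H^{−v}} and v-F_{H^{−u}} are both empty (i.e. H^{−v} contains no u-snake and no u-tadpole, and H^{−u} contains no v-snake and no v-tadpole). If Waiter has a winning strategy in the Client-Waiter game on H, then Waiter has a winning strategy on H whose first move is to offer the pair {u, v}. -/
variable {α : Type*} [DecidableEq α]

lemma card_sdiff_pair_lt {U : Finset α} {x y : α} (hx : x ∈ U) :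
    (U \ {x, y}).card < U.card :=
  lt_of_le_of_lt
    (Finset.card_le_card (by
      intro a ha
      simp only [Finset.mem_sdiff, Finset.mem_insert, Finset.mem_singleton,
        Finset.mem_erase] at ha ⊢
      tauto))
    (Finset.card_erase_lt_of_mem hx)

/-- Client-Waiter game played on the edge set `E`: Waiter has a winning strategy from the
position in which `U` is the set of unclaimed vertices and `C` is the set of vertices already
claimed by Client.  While at least two vertices are unclaimed, Waiter offers two distinct
unclaimed vertices `x, y`; Client claims one of them and Waiter gets the other.  A last
remaining unclaimed vertex goes to Client.  Waiter wins if at the end Client's vertices contain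
no edge of `E`. -/
def CWWaiterWins (E : Set (Finset α)) (U C : Finset α) : Prop :=
  if _h : 2 ≤ U.card then
    ∃ x, ∃ _hx : x ∈ U, ∃ y, ∃ _hy : y ∈ U, x ≠ y ∧
      CWWaiterWins E (U \ {x, y}) (insert x C) ∧ CWWaiterWins E (U \ {x, y}) (insert y C)
  else ∀ e ∈ E, ¬ e ⊆ C ∪ U
termination_by U.card
decreasing_by all_goals exact card_sdiff_pair_lt (by assumption)

/-- `P = (e₀, …, e_t)` is an `a`–`b` path: every `eᵢ` is an edge of `E`, `a ∈ e₀`,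
`b ∈ e_t`, and consecutive edges intersect. -/
def IsPathSeq (E : Set (Finset α)) (a b : α) (t : ℕ) (P : Fin (t + 1) → Finset α) : Prop :=
  (∀ i, P i ∈ E) ∧ a ∈ P 0 ∧ b ∈ P (Fin.last t) ∧
    ∀ i : Fin t, (P i.castSucc ∩ P i.succ).Nonempty

/-- The path is linear: consecutive edges intersect in exactly one vertex. -/
def IsLinearSeq (t : ℕ) (P : Fin (t + 1) → Finset α) : Prop :=
  ∀ i : Fin t, (P i.castSucc ∩ P i.succ).card = 1

/-- The `a`–`b` path is simple: `a` appears only in the first edge, `b` only in the last one,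
and two edges intersect only if they are consecutive. -/
def IsSimpleSeq (a b : α) (t : ℕ) (P : Fin (t + 1) → Finset α) : Prop :=
  (∀ i, a ∈ P i → i = 0) ∧ (∀ i, b ∈ P i → i = Fin.last t) ∧
    ∀ i j : Fin (t + 1), (P i ∩ P j).Nonempty → Nat.dist i.1 j.1 ≤ 1

/-- `b` is reachable from `a` by a simple linear path in the edge set `E`. -/
def SLReach (E : Set (Finset α)) (a b : α) : Prop :=
  ∃ t P, IsPathSeq E a b t P ∧ IsLinearSeq t P ∧ IsSimpleSeq a b t P

/-- The edges of the induced subhypergraph `H^{-v}`: edges of `E` not containing `v`. -/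
def edgesWithout (E : Set (Finset α)) (v : α) : Set (Finset α) := {e | e ∈ E ∧ v ∉ e}

/-- `P = (e₀, …, e_t)` is an `a`-snake: an `a`-path whose edges all have size exactly `3`
except for the last one, which has size at most `2`. -/
def IsSnakeSeq (E : Set (Finset α)) (a : α) (t : ℕ) (P : Fin (t + 1) → Finset α) : Prop :=
  (∀ i, P i ∈ E) ∧ a ∈ P 0 ∧ (∀ i : Fin t, (P i.castSucc ∩ P i.succ).Nonempty) ∧
    (∀ i, i ≠ Fin.last t → (P i).card = 3) ∧ (P (Fin.last t)).card ≤ 2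

/-- `E` contains an `a`-snake. -/
def IsSnake (E : Set (Finset α)) (a : α) : Prop := ∃ t P, IsSnakeSeq E a t P

/-- `Q = (f₀, …, f_{t+1})` is a `3`-uniform simple linear `a`-cycle (of length `t + 2 ≥ 2`):
all edges belong to `E` and have size `3`, `a` belongs to the first and last edges, consecutive
edges intersect; if the length is `2`, the two edges intersect in exactly two vertices, and
otherwise consecutive edges intersect in exactly one vertex and the first and last edges
intersect exactly in `{a}`; finally, two edges intersect only if they are consecutive or are
the first and last edges. -/
def IsSLCycleSeq (E : Set (Finset α)) (a : α) (t : ℕ) (Q : Fin (t + 2) → Finset α) : Prop :=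
  (∀ i, Q i ∈ E) ∧ (∀ i, (Q i).card = 3) ∧ a ∈ Q 0 ∧ a ∈ Q (Fin.last (t + 1)) ∧
    (∀ i : Fin (t + 1), (Q i.castSucc ∩ Q i.succ).Nonempty) ∧
    (if t = 0 then (Q 0 ∩ Q (Fin.last (t + 1))).card = 2
      else (∀ i : Fin (t + 1), (Q i.castSucc ∩ Q i.succ).card = 1) ∧
        Q 0 ∩ Q (Fin.last (t + 1)) = {a}) ∧
    ∀ i j : Fin (t + 2), (Q i ∩ Q j).Nonempty →
      Nat.dist i.1 j.1 ≤ 1 ∨ (i = 0 ∧ j = Fin.last (t + 1)) ∨ (j = 0 ∧ i = Fin.last (t + 1))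

/-- For `a ≠ b`, the data of an `a`–`b` tadpole: a `3`-uniform simple linear `a`–`b` path `P`,
a `3`-uniform simple linear `b`-cycle `Q`, such that `a` belongs to no edge of the cycle
(hence, the path being simple, to no edge other than the first one), `b` belongs only to the
first and last edges of the cycle (and, the path being simple, only to the last edge of the
path), and `b` is the only vertex appearing both in the path and in the cycle. -/
def IsTadpoleSeq (E : Set (Finset α)) (a b : α) (s : ℕ) (P : Fin (s + 1) → Finset α)
    (t : ℕ) (Q : Fin (t + 2) → Finset α) : Prop :=
  IsPathSeq E a b s P ∧ IsLinearSeq s P ∧ IsSimpleSeq a b s P ∧ (∀ i, (P i).card = 3) ∧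
    IsSLCycleSeq E b t Q ∧ (∀ j, a ∉ Q j) ∧
    (∀ j : Fin (t + 2), b ∈ Q j → j = 0 ∨ j = Fin.last (t + 1)) ∧
    ∀ x, (∃ i, x ∈ P i) → (∃ j, x ∈ Q j) → x = b

/-- `E` contains an `a`–`b` tadpole; for `a = b` this means a `3`-uniform simple linear
`a`-cycle. -/
def IsTadpole (E : Set (Finset α)) (a b : α) : Prop :=
  if a = b then ∃ t Q, IsSLCycleSeq E a t Q
  else ∃ s P t Q, IsTadpoleSeq E a b s P t Q

lemma fin_one_eq (i j : Fin (0 + 1)) : i = j := Fin.ext (by omega)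

/-- Edges of `E` contained in `S`. -/
def edgesIn (E : Set (Finset α)) (S : Finset α) : Set (Finset α) := {e | e ∈ E ∧ e ⊆ S}

def PathThree (F : Set (Finset α)) (a b : α) (t : ℕ) (P : Fin (t + 1) → Finset α) : Prop :=
  IsPathSeq F a b t P ∧ IsLinearSeq t P ∧ IsSimpleSeq a b t P ∧ ∀ i, (P i).card = 3

def ProperCycle (F : Set (Finset α)) (a : α) (t : ℕ) (Q : Fin (t + 2) → Finset α) : Prop :=
  IsSLCycleSeq F a t Q ∧ ∀ j : Fin (t + 2), a ∈ Q j → j = 0 ∨ j = Fin.last (t + 1)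

lemma IsPathSeq.mono' {F F' : Set (Finset α)} (h : F ⊆ F') {a b : α} {t : ℕ}
    {P : Fin (t + 1) → Finset α} (hP : IsPathSeq F a b t P) : IsPathSeq F' a b t P :=
  ⟨fun i => h (hP.1 i), hP.2⟩

lemma IsSLCycleSeq.mono' {F F' : Set (Finset α)} (h : F ⊆ F') {a : α} {t : ℕ}
    {P : Fin (t + 2) → Finset α} (hP : IsSLCycleSeq F a t P) : IsSLCycleSeq F' a t P :=
  ⟨fun i => h (hP.1 i), hP.2⟩

lemma IsSnakeSeq.mono' {F F' : Set (Finset α)} (h : F ⊆ F') {a : α} {t : ℕ}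
    {P : Fin (t + 1) → Finset α} (hP : IsSnakeSeq F a t P) : IsSnakeSeq F' a t P :=
  ⟨fun i => h (hP.1 i), hP.2⟩

lemma IsTadpoleSeq.mono' {F F' : Set (Finset α)} (h : F ⊆ F') {a b : α} {s t : ℕ}
    {P : Fin (s + 1) → Finset α} {Q : Fin (t + 2) → Finset α}
    (hP : IsTadpoleSeq F a b s P t Q) : IsTadpoleSeq F' a b s P t Q :=
  ⟨hP.1.mono' h, hP.2.1, hP.2.2.1, hP.2.2.2.1, hP.2.2.2.2.1.mono' h, hP.2.2.2.2.2⟩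

lemma PathThree.mono' {F F' : Set (Finset α)} (h : F ⊆ F') {a b : α} {t : ℕ}
    {P : Fin (t + 1) → Finset α} (hP : PathThree F a b t P) : PathThree F' a b t P :=
  ⟨hP.1.mono' h, hP.2⟩

lemma edgesIn_mono {E : Set (Finset α)} {S T : Finset α} (h : S ⊆ T) :
    edgesIn E S ⊆ edgesIn E T := fun _ he => ⟨he.1, he.2.trans h⟩

lemma waiter_wins_mono (E : Set (Finset α)) : ∀ (n : ℕ) (U C U' C' : Finset α), U.card = n →
    CWWaiterWins E U C → C' ⊆ C → U' ⊆ U ∪ C → CWWaiterWins E U' C' := by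
  intro n
  induction n using Nat.strong_induction_on with
  | _ n ih =>
  intro U C U' C' hn hW hC hU
  by_cases h2 : 2 ≤ U.card
  · rw [CWWaiterWins, dif_pos h2] at hW
    obtain ⟨x, hx, y, hy, hxy, hWx, hWy⟩ := hW
    have hlt : (U \ {x, y}).card < n := hn ▸ card_sdiff_pair_lt hx
    by_cases hx' : x ∈ U'
    · by_cases hy' : y ∈ U'
      · have h2' : 2 ≤ U'.card := by
          have : ({x, y} : Finset α) ⊆ U' := by
            intro z hz; simp at hz; rcases hz with rfl | rfl <;> assumption
          have := Finset.card_le_card this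
          rwa [Finset.card_pair hxy] at this
        rw [CWWaiterWins, dif_pos h2']
        refine ⟨x, hx', y, hy', hxy, ?_, ?_⟩
        · refine ih _ hlt _ _ _ _ rfl hWx (Finset.insert_subset_insert _ hC) ?_
          intro z hz
          have := @hU z
          simp at hz this ⊢; tauto
        · refine ih _ hlt _ _ _ _ rfl hWy (Finset.insert_subset_insert _ hC) ?_
          intro z hz
          have := @hU z
          simp at hz this ⊢; tauto
      · refine ih _ hlt _ _ _ _ rfl hWx (hC.trans (Finset.subset_insert _ _)) ?_
        intro z hz
        have hzy : z ≠ y := fun h => hy' (h ▸ hz)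
        have := hU hz
        simp at this ⊢; tauto
    · refine ih _ hlt _ _ _ _ rfl hWy (hC.trans (Finset.subset_insert _ _)) ?_
      intro z hz
      have hzy : z ≠ x := fun h => hx' (h ▸ hz)
      have := hU hz
      simp at this ⊢; tauto
  · rw [CWWaiterWins, dif_neg h2] at hW
    have key : ∀ (m : ℕ) (A B : Finset α), A.card = m → A ⊆ U ∪ C → B ⊆ U ∪ C →
        CWWaiterWins E A B := by
      intro m
      induction m using Nat.strong_induction_on with
      | _ m ih2 =>
      intro A B hm hA hB
      rw [CWWaiterWins]
      split_ifs with hc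
      · obtain ⟨x, hx, y, hy, hxy⟩ := Finset.one_lt_card.1 hc
        have hs : A \ {x, y} ⊆ U ∪ C := Finset.sdiff_subset.trans hA
        exact ⟨x, hx, y, hy, hxy,
          ih2 _ (hm ▸ card_sdiff_pair_lt hx) _ _ rfl hs (Finset.insert_subset (hA hx) hB),
          ih2 _ (hm ▸ card_sdiff_pair_lt hx) _ _ rfl hs (Finset.insert_subset (hA hy) hB)⟩
      · intro e he hsub
        refine hW e he (hsub.trans ?_)
        rw [Finset.union_comm C U]
        exact Finset.union_subset hB hA
    exact key _ U' C' rfl hU (hC.trans Finset.subset_union_right)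

lemma waiter_wins_add (E : Set (Finset α)) (D : Finset α) : ∀ (n : ℕ) (U C : Finset α),
    U.card = n → CWWaiterWins E U C → (∀ e ∈ E, e ⊆ U ∪ C ∪ D → Disjoint e D) →
    CWWaiterWins E U (C ∪ D) := by
  intro n
  induction n using Nat.strong_induction_on with
  | _ n ih =>
  intro U C hn hW hD
  rw [CWWaiterWins] at hW ⊢
  split_ifs at hW ⊢ with h2
  · obtain ⟨x, hx, y, hy, hxy, hWx, hWy⟩ := hW
    have hlt : (U \ {x, y}).card < n := hn ▸ card_sdiff_pair_lt hx
    refine ⟨x, hx, y, hy, hxy, ?_, ?_⟩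
    · rw [← Finset.insert_union]
      refine ih _ hlt _ _ rfl hWx fun e he hs => hD e he (hs.trans ?_)
      intro z hz
      simp at hz ⊢
      rcases hz with h | h | h | h <;> simp_all
    · rw [← Finset.insert_union]
      refine ih _ hlt _ _ rfl hWy fun e he hs => hD e he (hs.trans ?_)
      intro z hz
      simp at hz ⊢
      rcases hz with h | h | h | h <;> simp_all
  · intro e he hs
    have hd := hD e he (hs.trans (by intro z hz; simp at hz ⊢; tauto))
    refine hW e he ?_
    intro z hz
    have h1 := hs hz
    have h2 : z ∉ D := Finset.disjoint_left.1 hd hz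
    simp at h1 ⊢; tauto

lemma snake_cons {F F' : Set (Finset α)} (h : F' ⊆ F) {a c : α} {e : Finset α} (he : e ∈ F)
    (hc : c ∈ e) (ha : a ∈ e) (hcard : e.card = 3) (hS : IsSnake F' a) : IsSnake F c := by
  obtain ⟨t, P, h1, h2, h3, h4, h5⟩ := hS
  refine ⟨t + 1, Fin.cons e P, ?_, ?_, ?_, ?_, ?_⟩
  · intro i
    refine Fin.cases ?_ (fun i => ?_) i
    · simpa using he
    · simpa using h (h1 i)
  · simpa using hc
  · intro i
    refine Fin.cases ?_ (fun i => ?_) i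
    · exact ⟨a, by simp [ha, h2]⟩
    · simpa [← Fin.succ_castSucc] using h3 i
  · intro i
    refine Fin.cases ?_ (fun i => ?_) i
    · simpa using hcard
    · intro hi
      rw [Fin.cons_succ]
      refine h4 i fun hh => hi ?_
      rw [hh, Fin.succ_last]
  · rw [← Fin.succ_last, Fin.cons_succ]
    exact h5

lemma path_cons {F F' : Set (Finset α)} (h : F' ⊆ F) {a b c : α} {e : Finset α} (he : e ∈ F)
    (hc : c ∈ e) (ha : a ∈ e) (hb : b ∉ e) (hcard : e.card = 3) {t : ℕ}
    {P : Fin (t + 1) → Finset α} (hP : PathThree F' a b t P)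
    (hmeet : ∀ i x, x ∈ e → x ∈ P i → x = a) (hcP : ∀ i, c ∉ P i) :
    PathThree F c b (t + 1) (Fin.cons e P) := by
  obtain ⟨⟨h1, h2, h3, h4⟩, h5, ⟨h6, h7, h8⟩, h9⟩ := hP
  have h0 : ∀ i, (e ∩ P i).Nonempty → i = 0 := by
    rintro i ⟨x, hx⟩
    rw [Finset.mem_inter] at hx
    exact h6 i (hmeet i x hx.1 hx.2 ▸ hx.2)
  refine ⟨⟨?_, ?_, ?_, ?_⟩, ?_, ⟨?_, ?_, ?_⟩, ?_⟩
  · intro i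
    refine Fin.cases ?_ (fun i => ?_) i
    · simpa using he
    · simpa using h (h1 i)
  · simpa using hc
  · rw [← Fin.succ_last, Fin.cons_succ]
    exact h3
  · intro i
    refine Fin.cases ?_ (fun i => ?_) i
    · exact ⟨a, by simp [ha, h2]⟩
    · simpa [← Fin.succ_castSucc] using h4 i
  · intro i
    refine Fin.cases ?_ (fun i => ?_) i
    · rw [Finset.card_eq_one]
      refine ⟨a, ?_⟩
      ext x
      simp only [Fin.castSucc_zero, Fin.cons_zero, Fin.cons_succ, Finset.mem_inter,
        Finset.mem_singleton]
      exact ⟨fun hx => hmeet 0 x hx.1 hx.2, fun hx => hx ▸ ⟨ha, h2⟩⟩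
    · simpa [← Fin.succ_castSucc] using h5 i
  · intro i
    refine Fin.cases ?_ (fun i => ?_) i
    · simp
    · intro hh
      exact absurd (by simpa using hh) (hcP i)
  · intro i
    refine Fin.cases ?_ (fun i => ?_) i
    · intro hh
      exact absurd (by simpa using hh) hb
    · intro hh
      rw [h7 i (by simpa using hh), Fin.succ_last]
  · intro i j
    refine Fin.cases ?_ (fun i => ?_) i <;> refine Fin.cases ?_ (fun j => ?_) j
    · simp
    · intro hh
      have := h0 j (by simpa using hh)
      subst this
      simp [Nat.dist]
    · intro hh
      have := h0 i (by simpa [Finset.inter_comm] using hh)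
      subst this
      simp [Nat.dist]
    · intro hh
      have := h8 i j (by simpa using hh)
      simpa [Nat.dist] using this
  · intro i
    refine Fin.cases ?_ (fun i => ?_) i
    · simpa using hcard
    · simpa using h9 i

/-- A simple linear path from `a` to `c` closed up by an edge containing `a` and `c`. -/
lemma cycle_cons {F F' : Set (Finset α)} (h : F' ⊆ F) {a c : α} {e : Finset α} (he : e ∈ F)
    (hc : c ∈ e) (ha : a ∈ e) (hac : a ≠ c) (hcard : e.card = 3) {t : ℕ}
    {P : Fin (t + 1) → Finset α} (hP : PathThree F' a c t P)
    (hmeet : ∀ i x, x ∈ e → x ∈ P i → x = a ∨ x = c) :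
    ProperCycle F c t (Fin.cons e P) := by
  obtain ⟨⟨h1, h2, h3, h4⟩, h5, ⟨h6, h7, h8⟩, h9⟩ := hP
  have h0 : ∀ i, (e ∩ P i).Nonempty → i = 0 ∨ i = Fin.last t := by
    rintro i ⟨x, hx⟩
    rw [Finset.mem_inter] at hx
    rcases hmeet i x hx.1 hx.2 with rfl | rfl
    · exact Or.inl (h6 i hx.2)
    · exact Or.inr (h7 i hx.2)
  refine ⟨⟨?_, ?_, ?_, ?_, ?_, ?_, ?_⟩, ?_⟩
  · intro i
    refine Fin.cases ?_ (fun i => ?_) i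
    · simpa using he
    · simpa using h (h1 i)
  · intro i
    refine Fin.cases ?_ (fun i => ?_) i
    · simpa using hcard
    · simpa using h9 i
  · simpa using hc
  · rw [← Fin.succ_last, Fin.cons_succ]
    exact h3
  · intro i
    refine Fin.cases ?_ (fun i => ?_) i
    · exact ⟨a, by simp [ha, h2]⟩
    · simpa [← Fin.succ_castSucc] using h4 i
  · rw [← Fin.succ_last, Fin.cons_succ, Fin.cons_zero]
    split_ifs with ht
    · subst ht
      rw [Finset.card_eq_two]
      refine ⟨a, c, hac, ?_⟩
      ext x
      simp only [Finset.mem_inter, Finset.mem_insert, Finset.mem_singleton]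
      refine ⟨fun hx => hmeet _ x hx.1 hx.2, ?_⟩
      rintro (rfl | rfl)
      · exact ⟨ha, h2⟩
      · exact ⟨hc, h3⟩
    · have hne : (0 : Fin (t + 1)) ≠ Fin.last t := by
        intro hh
        have := congrArg Fin.val hh
        simp at this
        exact ht this.symm
      constructor
      · intro i
        refine Fin.cases ?_ (fun i => ?_) i
        · rw [Finset.card_eq_one]
          refine ⟨a, ?_⟩
          ext x
          simp only [Fin.castSucc_zero, Fin.cons_zero, Fin.cons_succ, Finset.mem_inter,
            Finset.mem_singleton]
          refine ⟨fun hx => ?_, fun hx => hx ▸ ⟨ha, h2⟩⟩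
          rcases hmeet 0 x hx.1 hx.2 with rfl | rfl
          · rfl
          · exact absurd (h7 _ hx.2) hne
        · simpa [← Fin.succ_castSucc] using h5 i
      · ext x
        simp only [Finset.mem_inter, Finset.mem_singleton]
        refine ⟨fun hx => ?_, fun hx => hx ▸ ⟨hc, h3⟩⟩
        rcases hmeet _ x hx.1 hx.2 with rfl | rfl
        · exact absurd (h6 _ hx.2).symm hne
        · rfl
  · intro i j
    refine Fin.cases ?_ (fun i => ?_) i <;> refine Fin.cases ?_ (fun j => ?_) j
    · simp
    · intro hh
      rcases h0 j (by simpa using hh) with rfl | rfl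
      · simp [Nat.dist]
      · simp
    · intro hh
      rcases h0 i (by simpa [Finset.inter_comm] using hh) with rfl | rfl
      · simp [Nat.dist]
      · simp
    · intro hh
      have := h8 i j (by simpa using hh)
      exact Or.inl (by simpa [Nat.dist] using this)
  · intro i
    refine Fin.cases ?_ (fun i => ?_) i
    · simp
    · intro hh
      rw [h7 i (by simpa using hh), Fin.succ_last]
      simp

lemma path_single {F : Set (Finset α)} {a b : α} {e : Finset α} (he : e ∈ F)
    (ha : a ∈ e) (hb : b ∈ e) (hcard : e.card = 3) : PathThree F a b 0 (fun _ => e) := by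
  refine ⟨⟨fun _ => he, ha, hb, fun i => i.elim0⟩, fun i => i.elim0,
    ⟨fun i _ => fin_one_eq _ _, fun i _ => fin_one_eq _ _, ?_⟩, fun _ => hcard⟩
  intro i j _
  rw [fin_one_eq i j]
  simp

structure GoodPos (E : Set (Finset α)) (U C : Finset α) : Prop where
  disj : ∀ x ∈ U, x ∉ C
  nz : ∀ e ∈ E, e ⊆ C → e = ∅
  snake : ∀ c ∈ C, ¬ IsSnake (edgesIn E (insert c U)) c
  cyc : ∀ c ∈ C, ∀ t Q, ¬ ProperCycle (edgesIn E (insert c U)) c t Q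
  tad : ∀ c ∈ C, ∀ b, c ≠ b → ∀ s P t Q, ¬ IsTadpoleSeq (edgesIn E (insert c U)) c b s P t Q
  path : ∀ c ∈ C, ∀ d ∈ C, c ≠ d → ∀ t P, ¬ PathThree (edgesIn E (insert c (insert d U))) c d t P

lemma PathThree.reverse' {F : Set (Finset α)} {a b : α} {t : ℕ} {P : Fin (t + 1) → Finset α}
    (hP : PathThree F a b t P) : PathThree F b a t (fun i => P i.rev) := by
  obtain ⟨⟨h1, h2, h3, h4⟩, h5, ⟨h6, h7, h8⟩, h9⟩ := hP
  refine ⟨⟨fun i => h1 _, by simpa using h3, by simpa using h2, fun i => ?_⟩, fun i => ?_,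
    ⟨fun i hi => ?_, fun i hi => ?_, fun i j hij => ?_⟩, fun i => h9 _⟩
  · have := h4 i.rev
    rw [Finset.inter_comm] at this
    simpa [Fin.rev_castSucc, Fin.rev_succ] using this
  · have := h5 i.rev
    rw [Finset.inter_comm] at this
    simpa [Fin.rev_castSucc, Fin.rev_succ] using this
  · have := h7 _ hi
    rw [← Fin.rev_zero] at this
    exact Fin.rev_injective this
  · have := h6 _ hi
    rw [← Fin.rev_last] at this
    exact Fin.rev_injective this
  · have := h8 _ _ hij
    simp only [Nat.dist, Fin.val_rev] at this ⊢
    omega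

lemma goodPos_step {E : Set (Finset α)} {U C : Finset α} (hrank : ∀ e ∈ E, e.card ≤ 3)
    (hG : GoodPos E U C) {c a b : α} (hc : c ∈ C) (ha : a ∈ U) (hb : b ∈ U) (hab : a ≠ b)
    (he : ({c, a, b} : Finset α) ∈ E) : GoodPos E (U \ {a, b}) (insert a C) := by
  have haC := hG.disj a ha
  have hbC := hG.disj b hb
  have hcU : c ∉ U := fun h => hG.disj c h hc
  have hca : c ≠ a := fun h => haC (h ▸ hc)
  have hcb : c ≠ b := fun h => hbC (h ▸ hc)
  have hUU : U \ {a, b} ⊆ U := Finset.sdiff_subset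
  have hcard : ({c, a, b} : Finset α).card = 3 := by
    rw [Finset.card_eq_three]; exact ⟨c, a, b, hca, hcb, hab, rfl⟩
  have heF : ({c, a, b} : Finset α) ∈ edgesIn E (insert c U) :=
    ⟨he, by intro z hz; simp at hz ⊢; rcases hz with rfl | rfl | rfl <;> tauto⟩
  have hsub : insert a (U \ {a, b}) ⊆ insert c U := by
    intro z hz; simp at hz ⊢; rcases hz with rfl | h <;> tauto
  have hF := edgesIn_mono (E := E) hsub
  have hmem : ∀ f ∈ edgesIn E (insert a (U \ {a, b})), b ∉ f ∧ c ∉ f := by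
    intro f hf
    constructor
    · intro h
      have := hf.2 h
      simp at this; tauto
    · intro h
      have := hf.2 h
      simp at this; tauto
  -- no path from `a` to an old root
  have hpath : ∀ d ∈ C, ∀ t P,
      ¬ PathThree (edgesIn E (insert a (insert d (U \ {a, b})))) a d t P := by
    intro d hd t P hP
    have hda : a ≠ d := fun h => haC (h ▸ hd)
    have hdb : b ≠ d := fun h => hbC (h ▸ hd)
    have hbP : ∀ i, b ∉ P i := by
      intro i h
      have := (hP.1.1 i).2 h
      simp [hdb, hab.symm] at this
    by_cases hdc : d = c
    · subst hdc
      refine hG.cyc d hc t (Fin.cons {d, a, b} P) (cycle_cons (edgesIn_mono ?_) heF (by simp)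
        (by simp) hda hcard hP ?_)
      · intro z hz; simp at hz ⊢; rcases hz with rfl | rfl | h <;> tauto
      · intro i x hx hxP
        have : x ≠ b := fun h => hbP i (h ▸ hxP)
        simp at hx; tauto
    · have hcP : ∀ i, c ∉ P i := by
        intro i h
        have := (hP.1.1 i).2 h
        simp [hca, Ne.symm hdc, hcU] at this
      refine hG.path c hc d hd (Ne.symm hdc) (t + 1) (Fin.cons {c, a, b} P)
        (path_cons (edgesIn_mono ?_) (edgesIn_mono ?_ heF) (by simp) (by simp) ?_ hcard hP ?_ hcP)
      · intro z hz; simp at hz ⊢; rcases hz with rfl | rfl | h <;> tauto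
      · intro z hz; simp at hz ⊢; tauto
      · simp [hdc, hda.symm, hdb.symm]
      · intro i x hx hxP
        have h1 : x ≠ b := fun h => hbP i (h ▸ hxP)
        have h2 : x ≠ c := fun h => hcP i (h ▸ hxP)
        simp at hx; tauto
  refine ⟨?_, ?_, ?_, ?_, ?_, ?_⟩
  · intro x hx
    simp at hx ⊢
    exact ⟨hx.2.1, hG.disj x hx.1⟩
  · intro f hf hfC
    by_cases haf : a ∈ f
    · exfalso
      have hfe : f.erase a ⊆ C := by
        intro z hz
        have := hfC (Finset.mem_of_mem_erase hz)
        simp at hz this; tauto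
      have hcf : (f.erase a).card ≤ 2 := by
        have := hrank f hf
        rw [Finset.card_erase_of_mem haf]; omega
      have hfi : f = insert a (f.erase a) := (Finset.insert_erase haf).symm
      by_cases h2 : (f.erase a).card = 2
      · obtain ⟨p, q, hpq, hpqe⟩ := Finset.card_eq_two.1 h2
        have hp : p ∈ C := hfe (by simp [hpqe])
        have hq : q ∈ C := hfe (by simp [hpqe])
        rw [hpqe] at hfi
        refine hG.path p hp q hq hpq 0 (fun _ => f) (path_single ⟨hf, ?_⟩ ?_ ?_ ?_)
        · rw [hfi]; intro z hz; simp at hz ⊢; rcases hz with rfl | h <;> tauto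
        · rw [hfi]; simp
        · rw [hfi]; simp
        · rw [← Finset.card_erase_add_one haf, h2]
      · have hc2 : f.card ≤ 2 := by
          rw [← Finset.card_erase_add_one haf]; omega
        rcases (f.erase a).eq_empty_or_nonempty with h0 | ⟨p, hp⟩
        · rw [h0] at hfi
          refine hG.snake c hc (snake_cons (F' := edgesIn E (insert a (U \ {a, b}))) hF heF
            (a := a) (by simp) (by simp) hcard ⟨0, fun _ => f, ?_⟩)
          refine ⟨fun _ => ⟨hf, ?_⟩, haf, fun i => i.elim0,
            fun i hi => absurd (fin_one_eq _ _) hi, hc2⟩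
          rw [hfi]; intro z hz; simp at hz ⊢; tauto
        · have hpe : f.erase a = {p} := by
            symm
            refine Finset.eq_of_subset_of_card_le (by simpa using hp) ?_
            simp only [Finset.card_singleton]; omega
          rw [hpe] at hfi
          refine hG.snake p (hfe hp) ⟨0, fun _ => f, fun _ => ⟨hf, ?_⟩,
            Finset.mem_of_mem_erase hp, fun i => i.elim0,
            fun i hi => absurd (fin_one_eq _ _) hi, hc2⟩
          rw [hfi]; intro z hz; simp at hz ⊢; rcases hz with rfl | h <;> tauto
    · refine hG.nz f hf fun z hz => ?_
      have h1 := hfC hz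
      have h2 : z ≠ a := fun h => haf (h ▸ hz)
      simp at h1; tauto
  · intro d hd
    rcases Finset.mem_insert.1 hd with rfl | hd
    · exact fun hS => hG.snake c hc (snake_cons hF heF (by simp) (by simp) hcard hS)
    · rintro ⟨t, P, hP⟩
      exact hG.snake d hd ⟨t, P, hP.mono' (edgesIn_mono (Finset.insert_subset_insert _ hUU))⟩
  · intro d hd t Q hQ
    rcases Finset.mem_insert.1 hd with rfl | hd
    · have hp : PathThree (edgesIn E (insert c U)) c d 0 (fun _ => {c, d, b}) :=
        path_single heF (by simp) (by simp) hcard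
      refine hG.tad c hc d hca 0 (fun _ => {c, d, b}) t Q
        ⟨hp.1, hp.2.1, hp.2.2.1, hp.2.2.2, hQ.1.mono' hF, ?_, hQ.2, ?_⟩
      · exact fun j => (hmem _ (hQ.1.1 j)).2
      · rintro x ⟨_, hx⟩ ⟨j, hj⟩
        have := hmem _ (hQ.1.1 j)
        have h1 : x ≠ b := fun h => this.1 (h ▸ hj)
        have h2 : x ≠ c := fun h => this.2 (h ▸ hj)
        simp at hx; tauto
    · exact hG.cyc d hd t Q
        ⟨hQ.1.mono' (edgesIn_mono (Finset.insert_subset_insert _ hUU)), hQ.2⟩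
  · intro d hd x hdx s P t Q hT
    rcases Finset.mem_insert.1 hd with rfl | hd
    · obtain ⟨h1, h2, h3, h4, h5, h6, h7, h8⟩ := hT
      have hxb : x ≠ b := fun h => (hmem _ (h1.1 (Fin.last s))).1 (h ▸ h1.2.2.1)
      have hxc : x ≠ c := fun h => (hmem _ (h1.1 (Fin.last s))).2 (h ▸ h1.2.2.1)
      have hp : PathThree (edgesIn E (insert c U)) c x (s + 1) (Fin.cons {c, d, b} P) := by
        refine path_cons hF heF (by simp) (by simp) (by simp [hxb, hxc, hdx.symm]) hcard
          ⟨h1, h2, h3, h4⟩ ?_ (fun i => (hmem _ (h1.1 i)).2)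
        intro i y hy hyP
        have := hmem _ (h1.1 i)
        have h1 : y ≠ b := fun h => this.1 (h ▸ hyP)
        have h2 : y ≠ c := fun h => this.2 (h ▸ hyP)
        simp at hy; tauto
      refine hG.tad c hc x hxc.symm (s + 1) (Fin.cons {c, d, b} P) t Q
        ⟨hp.1, hp.2.1, hp.2.2.1, hp.2.2.2, h5.mono' hF, ?_, h7, ?_⟩
      · exact fun j => (hmem _ (h5.1 j)).2
      · rintro y ⟨i, hi⟩ ⟨j, hj⟩
        revert hi
        refine Fin.cases ?_ (fun i => ?_) i
        · intro hy
          have := hmem _ (h5.1 j)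
          have h1 : y ≠ b := fun h => this.1 (h ▸ hj)
          have h2 : y ≠ c := fun h => this.2 (h ▸ hj)
          have h3 : y ≠ d := fun h => h6 j (h ▸ hj)
          simp at hy; tauto
        · intro hy
          exact h8 y ⟨i, by simpa using hy⟩ ⟨j, hj⟩
    · exact hG.tad d hd x hdx s P t Q
        (hT.mono' (edgesIn_mono (Finset.insert_subset_insert _ hUU)))
  · intro d hd d' hd' hne t P hP
    rcases Finset.mem_insert.1 hd with rfl | hdC <;>
      rcases Finset.mem_insert.1 hd' with rfl | hdC'
    · exact hne rfl
    · exact hpath d' hdC' t P hP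
    · rw [Finset.insert_comm] at hP
      exact hpath d hdC t _ hP.reverse'
    · exact hG.path d hdC d' hdC' hne t P (hP.mono' (edgesIn_mono
        (Finset.insert_subset_insert _ (Finset.insert_subset_insert _ hUU))))

lemma goodPos_wins {E : Set (Finset α)} (hrank : ∀ e ∈ E, e.card ≤ 3) :
    ∀ (n : ℕ) (U C : Finset α), U.card = n → GoodPos E U C → CWWaiterWins E U ∅ →
      CWWaiterWins E U C := by
  intro n
  induction n using Nat.strong_induction_on with
  | _ n ih =>
  intro U C hn hG hW
  by_cases hall : ∀ e ∈ E, e ⊆ U ∪ ∅ ∪ C → Disjoint e C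
  · have := waiter_wins_add E C _ U ∅ rfl hW hall
    rwa [Finset.empty_union] at this
  · push Not at hall
    obtain ⟨e, he, hsub, hnd⟩ := hall
    obtain ⟨c, hce, hc⟩ := Finset.not_disjoint_iff.1 hnd
    have hsub' : ∀ z ∈ e, z ∈ U ∨ z ∈ C := by
      intro z hz
      have := hsub hz
      simpa using this
    have huniq : ∀ d ∈ e, d ∈ C → d = c := by
      intro d hde hd
      by_contra hne
      by_cases hC : e ⊆ C
      · have := hG.nz e he hC
        simp [this] at hce
      · obtain ⟨x, hxe, hxC⟩ := Finset.not_subset.1 hC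
        have hxU : x ∈ U := (hsub' x hxe).resolve_right hxC
        have hxc : x ≠ c := fun h => hxC (h ▸ hc)
        have hxd : x ≠ d := fun h => hxC (h ▸ hd)
        have h3 : ({d, c, x} : Finset α).card = 3 :=
          Finset.card_eq_three.2 ⟨d, c, x, hne, hxd.symm, hxc.symm, rfl⟩
        have heq : ({d, c, x} : Finset α) = e := by
          refine Finset.eq_of_subset_of_card_le ?_ (h3 ▸ hrank e he)
          intro z hz; simp at hz; rcases hz with rfl | rfl | rfl <;> assumption
        refine hG.path d hd c hc hne 0 (fun _ => e) (path_single ⟨he, ?_⟩ hde hce (heq ▸ h3))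
        rw [← heq]; intro z hz; simp at hz ⊢; rcases hz with rfl | rfl | rfl <;> tauto
    have hrest : e.erase c ⊆ U := by
      intro z hz
      have hz' := Finset.mem_erase.1 hz
      exact (hsub' z hz'.2).resolve_right fun h => hz'.1 (huniq z hz'.2 h)
    have hcard : e.card = 3 := by
      by_contra h3
      have h2 : e.card ≤ 2 := by have := hrank e he; omega
      refine hG.snake c hc ⟨0, fun _ => e, fun _ => ⟨he, ?_⟩, hce, fun i => i.elim0,
        fun i hi => absurd (fin_one_eq _ _) hi, h2⟩
      rw [← Finset.insert_erase hce]
      exact Finset.insert_subset_insert _ hrest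
    obtain ⟨a, b, hab, heab⟩ := Finset.card_eq_two.1
      (show (e.erase c).card = 2 by rw [Finset.card_erase_of_mem hce, hcard])
    have ha : a ∈ U := hrest (by simp [heab])
    have hb : b ∈ U := hrest (by simp [heab])
    have heq : e = {c, a, b} := by rw [← heab, Finset.insert_erase hce]
    have h2 : 2 ≤ U.card := Finset.one_lt_card.2 ⟨a, ha, b, hb, hab⟩
    have hlt : (U \ {a, b}).card < n := hn ▸ card_sdiff_pair_lt ha
    have hW' : CWWaiterWins E (U \ {a, b}) ∅ :=
      waiter_wins_mono E _ U ∅ _ _ rfl hW (by simp) (by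
        rw [Finset.union_empty]; exact Finset.sdiff_subset)
    rw [CWWaiterWins, dif_pos h2]
    refine ⟨a, ha, b, hb, hab, ?_, ?_⟩
    · exact ih _ hlt _ _ rfl (goodPos_step hrank hG hc ha hb hab (heq ▸ he)) hW'
    · refine ih _ hlt _ _ rfl ?_ hW'
      rw [Finset.pair_comm]
      refine goodPos_step hrank hG hc hb ha hab.symm ?_
      rw [Finset.pair_comm]
      exact heq ▸ he

lemma win_after_first {V : Finset α} {E : Set (Finset α)} (hrank : ∀ e ∈ E, e.card ≤ 3)
    {u v : α} (huv : u ≠ v)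
    (hFu : ¬ (IsSnake (edgesWithout E v) u ∨ ∃ b, IsTadpole (edgesWithout E v) u b))
    (hwin : CWWaiterWins E V ∅) : CWWaiterWins E (V \ {u, v}) {u} := by
  have hF : edgesIn E (insert u (V \ {u, v})) ⊆ edgesWithout E v := by
    rintro e ⟨he, hs⟩
    refine ⟨he, fun h => ?_⟩
    have := hs h
    simp [huv.symm] at this
  have hW' : CWWaiterWins E (V \ {u, v}) ∅ :=
    waiter_wins_mono E _ V ∅ _ _ rfl hwin (by simp) (by
      rw [Finset.union_empty]; exact Finset.sdiff_subset)
  refine goodPos_wins hrank _ _ _ rfl ⟨?_, ?_, ?_, ?_, ?_, ?_⟩ hW'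
  · intro x hx
    simp at hx ⊢; tauto
  · intro e he hs
    rcases Finset.subset_singleton_iff.1 hs with h | h
    · exact h
    · refine absurd (Or.inl ⟨0, fun _ => e, fun _ => ⟨he, ?_⟩, ?_, fun i => i.elim0,
        fun i hi => absurd (fin_one_eq _ _) hi, ?_⟩) hFu
      · simp [h, huv.symm]
      · simp [h]
      · simp [h]
  · intro c hc
    rw [Finset.mem_singleton] at hc
    subst hc
    rintro ⟨t, P, hP⟩
    exact hFu (Or.inl ⟨t, P, hP.mono' hF⟩)
  · intro c hc t Q hQ
    rw [Finset.mem_singleton] at hc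
    subst hc
    refine hFu (Or.inr ⟨c, ?_⟩)
    rw [IsTadpole, if_pos rfl]
    exact ⟨t, Q, hQ.1.mono' hF⟩
  · intro c hc b hcb s P t Q hT
    rw [Finset.mem_singleton] at hc
    subst hc
    refine hFu (Or.inr ⟨b, ?_⟩)
    rw [IsTadpole, if_neg hcb]
    exact ⟨s, P, t, Q, hT.mono' hF⟩
  · intro c hc d hd hne
    rw [Finset.mem_singleton] at hc hd
    exact absurd (hc.trans hd.symm) hne

/-- Let `H = (V, E)` be a rank-`3` clutter and let `u, v ∈ V` be such that `H^{-v}` contains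
no `u`-snake and no `u`-tadpole, and `H^{-u}` contains no `v`-snake and no `v`-tadpole.  If
Waiter has a winning strategy in the Client-Waiter game on `H`, then Waiter has a winning
strategy whose first move is to offer the pair `{u, v}`: whichever of `u, v` Client claims,
the resulting position is again a Waiter win. -/
theorem cw_waiter_first_move_uv (V : Finset α) (E : Set (Finset α))
    (hEV : ∀ e ∈ E, e ⊆ V) (hrank : ∀ e ∈ E, e.card ≤ 3)
    (hclutter : ∀ e₁ ∈ E, ∀ e₂ ∈ E, e₁ ⊆ e₂ → e₁ = e₂)
    (u v : α) (hu : u ∈ V) (hv : v ∈ V) (huv : u ≠ v)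
    (hFu : ¬ (IsSnake (edgesWithout E v) u ∨ ∃ b, IsTadpole (edgesWithout E v) u b))
    (hFv : ¬ (IsSnake (edgesWithout E u) v ∨ ∃ b, IsTadpole (edgesWithout E u) v b))
    (hwin : CWWaiterWins E V ∅) :
    CWWaiterWins E (V \ {u, v}) {u} ∧ CWWaiterWins E (V \ {u, v}) {v} := by
  refine ⟨win_after_first hrank huv hFu hwin, ?_⟩
  rw [Finset.pair_comm]
  exact win_after_first hrank huv.symm hFv hwin
end

section
/- For every integer k ≥ 1 there exists a function omc_k : ℕ × ℕ → ℕ such that for every k-uniform hypergraph H = (V, E), every integer ℓ ≥ 1, and every subset Y ⊆ V with |Y| = y, the number of distinct sets C that are centers of minimal ℓ-sunflowers of H outside Y is at most omc_k(ℓ, y). -/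
section Defs

variable {α : Type*} [DecidableEq α]

/-- `S` is an `ℓ`-sunflower of the edge set `E` with center `C`: a tuple of `ℓ` edges
(repetitions allowed) all containing `C` and pairwise intersecting exactly in `C`. -/
def IsSunflower (E : Set (Finset α)) (ℓ : ℕ) (C : Finset α) (S : Fin ℓ → Finset α) : Prop :=
  (∀ i, S i ∈ E) ∧ (∀ i, C ⊆ S i) ∧ ∀ i j, i ≠ j → S i ∩ S j = C

/-- The `ℓ`-sunflower `S` with center `C` is outside `Y`: all its petals `S i \ C` are
disjoint from `Y`. -/
def IsSunflowerOutside (E : Set (Finset α)) (ℓ : ℕ) (Y C : Finset α)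
    (S : Fin ℓ → Finset α) : Prop :=
  IsSunflower E ℓ C S ∧ ∀ i, Disjoint (S i \ C) Y

/-- `C` is the center of some `ℓ`-sunflower of `E` outside `Y`. -/
def IsCenterOutside (E : Set (Finset α)) (ℓ : ℕ) (Y C : Finset α) : Prop :=
  ∃ S, IsSunflowerOutside E ℓ Y C S

/-- `C` is the center of a minimal `ℓ`-sunflower of `E` outside `Y`: no `ℓ`-sunflower of `E`
outside `Y` has a center strictly contained in `C`. -/
def IsMinCenterOutside (E : Set (Finset α)) (ℓ : ℕ) (Y C : Finset α) : Prop :=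
  IsCenterOutside E ℓ Y C ∧ ∀ C' : Finset α, C' ⊂ C → ¬ IsCenterOutside E ℓ Y C'

end Defs

/-- Indexed sunflower lemma (repetitions allowed). -/
theorem indexed_sunflower (m n : ℕ) : ∃ R : ℕ, ∀ (ι : Type u) (α : Type v) [DecidableEq α]
    (s : Finset ι) (f : ι → Finset α), (∀ i ∈ s, (f i).card ≤ n) → R ≤ s.card →
    ∃ t ⊆ s, t.card = m ∧ ∃ W : Finset α, ∀ i ∈ t, ∀ j ∈ t, i ≠ j → f i ∩ f j = W := by
  classical
  induction n with
  | zero =>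
    refine ⟨m, fun ι α _ s f hf hs => ?_⟩
    obtain ⟨t, hts, ht⟩ := Finset.exists_subset_card_eq hs
    refine ⟨t, hts, ht, ∅, fun i hi j _ _ => ?_⟩
    have := hf i (hts hi)
    have h0 : f i = ∅ := by
      rw [← Finset.card_eq_zero]; omega
    simp [h0]
  | succ n ih =>
    obtain ⟨R, hR⟩ := ih
    refine ⟨m + (m * (n + 1) * R + 1), fun ι α _ s f hf hs => ?_⟩
    let P : Finset (Finset ι) :=
      s.powerset.filter (fun t => ∀ i ∈ t, ∀ j ∈ t, i ≠ j → f i ∩ f j = ∅)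
    have hP : P.Nonempty := ⟨∅, by simp [P]⟩
    obtain ⟨t, htP, hmax⟩ := Finset.exists_max_image P Finset.card hP
    have ht := htP
    simp only [P, Finset.mem_filter, Finset.mem_powerset] at ht
    obtain ⟨hts, htd⟩ := ht
    by_cases hm : m ≤ t.card
    · obtain ⟨t', ht', hc⟩ := Finset.exists_subset_card_eq hm
      exact ⟨t', ht'.trans hts, hc, ∅, fun i hi j hj => htd i (ht' hi) j (ht' hj)⟩
    push Not at hm
    let X := t.biUnion f
    have hX : X.card ≤ m * (n + 1) := by
      calc X.card ≤ t.card * (n + 1) :=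
            Finset.card_biUnion_le_card_mul _ _ _ (fun i hi => hf i (hts hi))
        _ ≤ m * (n + 1) := Nat.mul_le_mul_right _ hm.le
    have hmeet : ∀ i ∈ s \ t, ∃ x, x ∈ X ∧ x ∈ f i := by
      intro i hi
      rw [Finset.mem_sdiff] at hi
      by_contra hcon
      push Not at hcon
      have hd : ∀ j ∈ t, f i ∩ f j = ∅ := by
        intro j hj
        ext x
        simp only [Finset.mem_inter, Finset.notMem_empty, iff_false, not_and]
        intro hx hx'
        exact hcon x (Finset.mem_biUnion.2 ⟨j, hj, hx'⟩) hx
      have hin : insert i t ∈ P := by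
        simp only [P, Finset.mem_filter, Finset.mem_powerset]
        refine ⟨Finset.insert_subset hi.1 hts, ?_⟩
        intro a ha b hb hab
        rw [Finset.mem_insert] at ha hb
        rcases ha with rfl | ha <;> rcases hb with rfl | hb
        · exact absurd rfl hab
        · exact hd b hb
        · rw [Finset.inter_comm]; exact hd a ha
        · exact htd a ha b hb hab
      have := hmax _ hin
      rw [Finset.card_insert_of_notMem hi.2] at this
      omega
    have hcard : m * (n + 1) * R < (s \ t).card := by
      have := Finset.le_card_sdiff t s
      omega
    have hne : (s \ t).Nonempty := Finset.card_pos.1 (by omega)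
    obtain ⟨i0, hi0⟩ := hne
    obtain ⟨x0, -, -⟩ := hmeet i0 hi0
    let g : ι → α := fun i => if h : i ∈ s \ t then (hmeet i h).choose else x0
    have hg : ∀ i ∈ s \ t, g i ∈ X ∧ g i ∈ f i := by
      intro i hi
      simp only [g, dif_pos hi]
      exact (hmeet i hi).choose_spec
    obtain ⟨x, hx, hfib⟩ := Finset.exists_lt_card_fiber_of_mul_lt_card_of_maps_to
      (s := s \ t) (t := X) (f := g) (n := R) (fun i hi => (hg i hi).1)
      (lt_of_le_of_lt (Nat.mul_le_mul_right _ hX) hcard)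
    have hmem : ∀ i ∈ (s \ t).filter (fun i => g i = x), i ∈ s ∧ x ∈ f i := by
      intro i hi
      rw [Finset.mem_filter] at hi
      refine ⟨(Finset.mem_sdiff.1 hi.1).1, ?_⟩
      rw [← hi.2]; exact (hg i hi.1).2
    obtain ⟨t', ht', hc, W, hW⟩ := hR ι α ((s \ t).filter (fun i => g i = x))
      (fun i => (f i).erase x) (by
        intro i hi
        have h1 := hmem i hi
        have h2 := hf i h1.1
        rw [Finset.card_erase_of_mem h1.2]; omega) hfib.le
    refine ⟨t', fun i hi => (hmem i (ht' hi)).1, hc, insert x W, ?_⟩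
    intro i hi j hj hij
    have hw := hW i hi j hj hij
    have h1 := (hmem i (ht' hi)).2
    have h2 := (hmem j (ht' hj)).2
    rw [← hw]
    ext z
    simp only [Finset.mem_inter, Finset.mem_insert, Finset.mem_erase]
    by_cases hz : z = x
    · subst hz; simp [h1, h2]
    · simp [hz]

/-- For every `k ≥ 1` there is a function `omc` such that every `k`-uniform hypergraph
`H = (V, E)` has, for every `ℓ ≥ 1` and every `Y ⊆ V`, at most `omc ℓ |Y|` distinct centers of
minimal `ℓ`-sunflowers outside `Y`. -/
theorem min_sunflower_centers_outside_bounded (k : ℕ) (hk : 1 ≤ k) :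
    ∃ omc : ℕ → ℕ → ℕ, ∀ (α : Type u) [DecidableEq α] (V : Finset α) (E : Set (Finset α)),
      (∀ e ∈ E, e ⊆ V) → (∀ e ∈ E, e.card = k) → ∀ ℓ : ℕ, 1 ≤ ℓ → ∀ Y : Finset α, Y ⊆ V →
        {C : Finset α | IsMinCenterOutside E ℓ Y C}.Finite ∧
          {C : Finset α | IsMinCenterOutside E ℓ Y C}.ncard ≤ omc ℓ Y.card := by
  classical
  choose R hR using indexed_sunflower.{u, u}
  let n : ℕ → ℕ → ℕ := fun ℓ y => ℓ * k + y
  let M : ℕ → ℕ → ℕ := fun ℓ y => (2 ^ n ℓ y) ^ (ℓ + 1) * (ℓ + 1) + 2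
  refine ⟨fun ℓ y => R (M ℓ y) (n ℓ y), ?_⟩
  intro α _ V E hEV hEk ℓ hℓ Y hYV
  have hfin : {C : Finset α | IsMinCenterOutside E ℓ Y C}.Finite := by
    refine Set.Finite.subset (V.powerset.finite_toSet) ?_
    rintro C ⟨⟨S, hS, -⟩, -⟩
    simp only [Finset.coe_powerset, Set.mem_preimage, Set.mem_powerset_iff, Finset.coe_subset]
    exact (hS.2.1 ⟨0, hℓ⟩).trans (hEV _ (hS.1 _))
  refine ⟨hfin, ?_⟩
  by_contra hlt
  push Not at hlt
  rw [Set.ncard_eq_toFinset_card _ hfin] at hlt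
  set s := hfin.toFinset with hs
  have hmin : ∀ C ∈ s, IsMinCenterOutside E ℓ Y C := by
    intro C hC
    simpa [hs] using hC
  have hex : ∀ C, ∃ S : Fin ℓ → Finset α, C ∈ s → IsSunflowerOutside E ℓ Y C S := by
    intro C
    by_cases hC : C ∈ s
    · obtain ⟨S, hS⟩ := (hmin C hC).1
      exact ⟨S, fun _ => hS⟩
    · exact ⟨fun _ => ∅, fun h => absurd h hC⟩
  choose e he using hex
  let U : Finset α → Finset α := fun C => (Finset.univ.biUnion (e C)) ∪ Y
  have hU : ∀ C ∈ s, (U C).card ≤ n ℓ Y.card := by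
    intro C hC
    refine (Finset.card_union_le _ _).trans (Nat.add_le_add_right ?_ _)
    have := Finset.card_biUnion_le_card_mul (Finset.univ : Finset (Fin ℓ)) (e C) k
      (fun i _ => (hEk _ ((he C hC).1.1 i)).le)
    simpa using this
  have heU : ∀ C j, e C j ⊆ U C := fun C j =>
    (Finset.subset_biUnion_of_mem (e C) (Finset.mem_univ j)).trans Finset.subset_union_left
  obtain ⟨t, hts, htc, W, hW⟩ := hR (M ℓ Y.card) (n ℓ Y.card) (Finset α) α s U hU hlt.le
  have hYW : Y ⊆ W ∧ W.card ≤ n ℓ Y.card := by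
    obtain ⟨a, ha, b, hb, hab⟩ := Finset.one_lt_card.1 (show 1 < t.card by
      rw [htc]; simp only [M]; omega)
    have := hW a ha b hb hab
    rw [← this]
    exact ⟨Finset.subset_inter Finset.subset_union_right Finset.subset_union_right,
      (Finset.card_le_card Finset.inter_subset_left).trans (hU a (hts ha))⟩
  obtain ⟨hYW, hWc⟩ := hYW
  let g : Finset α → Option (Fin ℓ) → Finset α := fun C o =>
    Option.elim o (C ∩ W) (fun j => e C j ∩ W)
  let T : Finset (Option (Fin ℓ) → Finset α) := Fintype.piFinset (fun _ => W.powerset)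
  have hT : T.card ≤ (2 ^ n ℓ Y.card) ^ (ℓ + 1) := by
    simp only [T, Fintype.card_piFinset, Finset.card_powerset, Finset.prod_const,
      Finset.card_univ, Fintype.card_option, Fintype.card_fin]
    exact Nat.pow_le_pow_left (Nat.pow_le_pow_right (by norm_num) hWc) _
  obtain ⟨c, hc, hfib⟩ := Finset.exists_lt_card_fiber_of_mul_lt_card_of_maps_to
    (s := t) (t := T) (f := g) (n := ℓ) (by
      intro C _
      simp only [T, Fintype.mem_piFinset, Finset.mem_powerset]
      rintro (_ | j)
      · exact Finset.inter_subset_right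
      · exact Finset.inter_subset_right) (by
      rw [htc]
      have h1 := Nat.mul_le_mul_right ℓ hT
      have h2 : (2 ^ n ℓ Y.card) ^ (ℓ + 1) * ℓ ≤ (2 ^ n ℓ Y.card) ^ (ℓ + 1) * (ℓ + 1) :=
        Nat.mul_le_mul_left _ (Nat.le_succ _)
      simp only [M]
      omega)
  set I := t.filter (fun C => g C = c) with hI
  have hIt : ∀ C ∈ I, C ∈ t := fun C hC => (Finset.mem_filter.1 hC).1
  have hIs : ∀ C ∈ I, C ∈ s := fun C hC => hts (hIt C hC)
  have hIg : ∀ C ∈ I, g C = c := fun C hC => (Finset.mem_filter.1 hC).2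
  have hD : ∀ C ∈ I, C ∩ W = c none := fun C hC => congrFun (hIg C hC) none
  have hDj : ∀ C ∈ I, ∀ j, e C j ∩ W = c (some j) := fun C hC j => congrFun (hIg C hC) (some j)
  obtain ⟨A, hA, B, hB, hAB⟩ := Finset.one_lt_card.1 (show 1 < I.card by omega)
  obtain ⟨I', hI', hI'c⟩ := Finset.exists_subset_card_eq hfib.le
  let φ := (I'.equivFinOfCardEq hI'c).symm
  have hφ : ∀ j, (φ j : Finset α) ∈ I := fun j => hI' (φ j).2
  have hDA : c none ⊆ A := by rw [← hD A hA]; exact Finset.inter_subset_left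
  have hss : c none ⊂ A := by
    refine Finset.ssubset_iff_subset_ne.2 ⟨hDA, fun heq => ?_⟩
    have hsub : A ⊆ B := by
      rw [← heq, ← hD B hB]; exact Finset.inter_subset_left
    exact (hmin B (hIs B hB)).2 A (Finset.ssubset_iff_subset_ne.2 ⟨hsub, hAB⟩)
      (hmin A (hIs A hA)).1
  refine (hmin A (hIs A hA)).2 _ hss ⟨fun j => e (φ j) j, ⟨?_, ?_, ?_⟩, ?_⟩
  · exact fun j => (he _ (hIs _ (hφ j))).1.1 j
  · intro j
    rw [← hD _ (hφ j)]
    exact Finset.inter_subset_left.trans ((he _ (hIs _ (hφ j))).1.2.1 j)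
  · intro i j hij
    have hne : (φ i : Finset α) ≠ φ j := fun h => hij (φ.injective (Subtype.ext h))
    have hi := he _ (hIs _ (hφ i))
    have hj := he _ (hIs _ (hφ j))
    apply Finset.Subset.antisymm
    · intro x hx
      rw [Finset.mem_inter] at hx
      have hxW : x ∈ W := by
        rw [← hW _ (hIt _ (hφ i)) _ (hIt _ (hφ j)) hne]
        exact Finset.mem_inter.2 ⟨heU _ _ hx.1, heU _ _ hx.2⟩
      have hx2 : x ∈ e (φ i) j ∩ W := by
        rw [hDj _ (hφ i) j, ← hDj _ (hφ j) j]
        exact Finset.mem_inter.2 ⟨hx.2, hxW⟩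
      rw [← hD _ (hφ i), ← hi.1.2.2 i j hij]
      exact Finset.mem_inter.2 ⟨Finset.mem_inter.2 ⟨hx.1, (Finset.mem_inter.1 hx2).1⟩, hxW⟩
    · apply Finset.subset_inter
      · rw [← hD _ (hφ i)]
        exact Finset.inter_subset_left.trans (hi.1.2.1 i)
      · rw [← hD _ (hφ j)]
        exact Finset.inter_subset_left.trans (hj.1.2.1 j)
  · intro j
    rw [Finset.disjoint_left]
    intro x hx hxY
    rw [Finset.mem_sdiff] at hx
    apply hx.2
    rw [← hD _ (hφ j)]
    refine Finset.mem_inter.2 ⟨?_, hYW hxY⟩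
    by_contra hxC
    exact Finset.disjoint_left.1 ((he _ (hIs _ (hφ j))).2 j) (Finset.mem_sdiff.2 ⟨hx.1, hxC⟩) hxY
end

section
/- Let k ≥ 1 and let H = (V, E) be a k-uniform hypergraph containing 2^k pairwise disjoint edges. Then Waiter has a winning strategy in the Waiter-Client game on H. -/
variable {α : Type*} [DecidableEq α]

/-- Waiter-Client game played on the edge set `E`: Waiter has a winning strategy from the
position in which `U` is the set of unclaimed vertices and `W` is the set of vertices already
claimed by Waiter.  While at least two vertices are unclaimed, Waiter offers two distinct
unclaimed vertices `x, y`; Client claims one of them and Waiter gets the other.  A last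
remaining unclaimed vertex goes to Client.  Waiter wins if at the end her vertices contain an
edge of `E`. -/
def WCWaiterWins (E : Set (Finset α)) (U W : Finset α) : Prop :=
  if _h : 2 ≤ U.card then
    ∃ x, ∃ _hx : x ∈ U, ∃ y, ∃ _hy : y ∈ U, x ≠ y ∧
      WCWaiterWins E (U \ {x, y}) (insert x W) ∧ WCWaiterWins E (U \ {x, y}) (insert y W)
  else ∃ e ∈ E, e ⊆ W
termination_by U.card
decreasing_by all_goals exact card_sdiff_pair_lt (by assumption)

/-- If Waiter already owns an edge, she wins by playing arbitrarily. -/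
lemma wins_of_owned (E : Set (Finset α)) : ∀ (n : ℕ) (U W : Finset α), U.card = n →
    (∃ e ∈ E, e ⊆ W) → WCWaiterWins E U W := by
  intro n
  induction n using Nat.strong_induction_on with
  | _ n ih =>
    intro U W hn hW
    rw [WCWaiterWins]
    split_ifs with h
    · obtain ⟨x, hx, y, hy, hxy⟩ := Finset.one_lt_card.mp h
      obtain ⟨e, he, heW⟩ := hW
      have hlt := card_sdiff_pair_lt (y := y) hx
      exact ⟨x, hx, y, hy, hxy,
        ih _ (hn ▸ hlt) _ _ rfl ⟨e, he, heW.trans (Finset.subset_insert _ _)⟩,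
        ih _ (hn ▸ hlt) _ _ rfl ⟨e, he, heW.trans (Finset.subset_insert _ _)⟩⟩
    · exact hW

/-- Position inside a phase: `A` holds the untouched remainders of size `m + 1`, `B` the
remainders of size `m`. -/
structure PhaseInv (E : Set (Finset α)) (m : ℕ) (U W : Finset α)
    (A B : Finset (Finset α)) : Prop where
  cardA : ∀ r ∈ A, r.card = m + 1
  cardB : ∀ r ∈ B, r.card = m
  disj : ∀ r ∈ A ∪ B, ∀ s ∈ A ∪ B, r ≠ s → Disjoint r s
  sub : ∀ r ∈ A ∪ B, r ⊆ U
  good : ∀ r ∈ A ∪ B, ∃ e ∈ E, e ⊆ W ∪ r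
  big : 2 ^ (m + 1) ≤ A.card + 2 * B.card

lemma PhaseInv.step {E : Set (Finset α)} {m : ℕ} {U W : Finset α}
    {A B : Finset (Finset α)} (h : PhaseInv E m U W A B) (hW : ¬ ∃ e ∈ E, e ⊆ W)
    {r s : Finset α} (hr : r ∈ A) (hs : s ∈ A) (hrs : r ≠ s) {x y : α}
    (hx : x ∈ r) (hy : y ∈ s) :
    PhaseInv E m (U \ {x, y}) (insert x W) ((A.erase r).erase s)
      (insert (r.erase x) B) := by
  have hrU : r ∈ A ∪ B := Finset.mem_union_left _ hr
  have hsU : s ∈ A ∪ B := Finset.mem_union_left _ hs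
  have hnAB : ∀ t ∈ B, t ∉ A := fun t ht ht' => by
    have h1 := h.cardA t ht'
    have h2 := h.cardB t ht
    omega
  have hdrs := h.disj r hrU s hsU hrs
  have hyr : y ∉ r := fun hc => Finset.disjoint_left.mp hdrs hc hy
  -- an old remainder which survives is different from `r` and `s`
  have old : ∀ t, t ∈ (A.erase r).erase s ∨ t ∈ B → t ∈ A ∪ B ∧ t ≠ r ∧ t ≠ s := by
    rintro t (ht | ht)
    · simp only [Finset.mem_erase] at ht
      exact ⟨Finset.mem_union_left _ ht.2.2, ht.2.1, ht.1⟩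
    · exact ⟨Finset.mem_union_right _ ht, fun hc => hnAB t ht (hc ▸ hr),
        fun hc => hnAB t ht (hc ▸ hs)⟩
  have cases_mem : ∀ t ∈ (A.erase r).erase s ∪ insert (r.erase x) B,
      t = r.erase x ∨ (t ∈ A ∪ B ∧ t ≠ r ∧ t ≠ s) := by
    intro t ht
    rw [Finset.mem_union, Finset.mem_insert] at ht
    rcases ht with ht | ht | ht
    · exact Or.inr (old t (Or.inl ht))
    · exact Or.inl ht
    · exact Or.inr (old t (Or.inr ht))
  have hnot : r.erase x ∉ B := by
    intro hc
    obtain ⟨hc1, hc2, -⟩ := old _ (Or.inr hc)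
    have hd := h.disj _ hc1 r hrU hc2
    have he : r.erase x = ∅ := by
      have := Finset.disjoint_of_subset_right (Finset.erase_subset x r) hd
      simpa using this
    apply hW
    simpa [he] using h.good _ hc1
  refine ⟨?_, ?_, ?_, ?_, ?_, ?_⟩
  · intro t ht
    simp only [Finset.mem_erase] at ht
    exact h.cardA t ht.2.2
  · intro t ht
    rcases Finset.mem_insert.mp ht with rfl | ht
    · rw [Finset.card_erase_of_mem hx, h.cardA r hr]; rfl
    · exact h.cardB t ht
  · intro t ht u hu htu
    rcases cases_mem t ht with rfl | ⟨ht1, ht2, -⟩ <;>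
      rcases cases_mem u hu with rfl | ⟨hu1, hu2, -⟩
    · exact absurd rfl htu
    · exact Finset.disjoint_of_subset_left (Finset.erase_subset x r)
        (h.disj r hrU u hu1 hu2.symm)
    · exact Finset.disjoint_of_subset_right (Finset.erase_subset x r)
        (h.disj t ht1 r hrU ht2)
    · exact h.disj t ht1 u hu1 htu
  · intro t ht a ha
    simp only [Finset.mem_sdiff, Finset.mem_insert, Finset.mem_singleton, not_or]
    rcases cases_mem t ht with rfl | ⟨ht1, ht2, ht3⟩
    · rw [Finset.mem_erase] at ha
      exact ⟨h.sub r hrU ha.2, ha.1, fun hc => hyr (hc ▸ ha.2)⟩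
    · refine ⟨h.sub t ht1 ha, ?_, ?_⟩
      · rintro rfl
        exact Finset.disjoint_left.mp (h.disj t ht1 r hrU ht2) ha hx
      · rintro rfl
        exact Finset.disjoint_left.mp (h.disj t ht1 s hsU ht3) ha hy
  · intro t ht
    rcases cases_mem t ht with rfl | ⟨ht1, -, -⟩
    · obtain ⟨e, he, hes⟩ := h.good r hrU
      refine ⟨e, he, fun a ha => ?_⟩
      have := hes ha
      simp only [Finset.mem_union, Finset.mem_insert, Finset.mem_erase] at this ⊢
      tauto
    · obtain ⟨e, he, hes⟩ := h.good t ht1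
      exact ⟨e, he, hes.trans (Finset.union_subset_union_left (Finset.subset_insert _ _))⟩
  · have h1 : s ∈ A.erase r := Finset.mem_erase.mpr ⟨hrs.symm, hs⟩
    have h2 := Finset.card_erase_add_one h1
    have h3 := Finset.card_erase_add_one hr
    have h4 := Finset.card_insert_of_notMem hnot
    have h5 := h.big
    omega

/-- `2 ^ m` disjoint remainders of size `m` suffice. -/
lemma wins_of_family (E : Set (Finset α)) : ∀ (m : ℕ) (U W : Finset α)
    (F : Finset (Finset α)), (∀ r ∈ F, r.card = m) →
    (∀ r ∈ F, ∀ s ∈ F, r ≠ s → Disjoint r s) → (∀ r ∈ F, r ⊆ U) →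
    (∀ r ∈ F, ∃ e ∈ E, e ⊆ W ∪ r) → 2 ^ m ≤ F.card → WCWaiterWins E U W := by
  intro m
  induction m with
  | zero =>
    intro U W F hc _ _ hg hb
    obtain ⟨r, hr⟩ := Finset.card_pos.mp (lt_of_lt_of_le (by norm_num) hb)
    have hr0 := Finset.card_eq_zero.mp (hc r hr)
    exact wins_of_owned E _ U W rfl (by simpa [hr0] using hg r hr)
  | succ m ihm =>
    have key : ∀ (n : ℕ) (U W : Finset α) (A B : Finset (Finset α)), U.card = n →
        PhaseInv E m U W A B → WCWaiterWins E U W := by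
      intro n
      induction n using Nat.strong_induction_on with
      | _ n ih =>
        intro U W A B hn h
        by_cases hW : ∃ e ∈ E, e ⊆ W
        · exact wins_of_owned E _ U W rfl hW
        by_cases hA : 1 < A.card
        · obtain ⟨r, hr, s, hs, hrs⟩ := Finset.one_lt_card.mp hA
          obtain ⟨x, hx⟩ := Finset.card_pos.mp (by rw [h.cardA r hr]; omega : 0 < r.card)
          obtain ⟨y, hy⟩ := Finset.card_pos.mp (by rw [h.cardA s hs]; omega : 0 < s.card)
          have hxU := h.sub r (Finset.mem_union_left _ hr) hx
          have hyU := h.sub s (Finset.mem_union_left _ hs) hy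
          have hxy : x ≠ y := by
            rintro rfl
            exact Finset.disjoint_left.mp (h.disj r (Finset.mem_union_left _ hr) s
              (Finset.mem_union_left _ hs) hrs) hx hy
          have hlt := card_sdiff_pair_lt (y := y) hxU
          have hU2 : 2 ≤ U.card := Finset.one_lt_card.mpr ⟨x, hxU, y, hyU, hxy⟩
          rw [WCWaiterWins, dif_pos hU2]
          have h2 := h.step hW hs hr hrs.symm hy hx
          rw [Finset.pair_comm] at h2
          exact ⟨x, hxU, y, hyU, hxy, ih _ (hn ▸ hlt) _ _ _ _ rfl
            (h.step hW hr hs hrs hx hy), ih _ (hn ▸ hlt) _ _ _ _ rfl h2⟩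
        · refine ihm U W B h.cardB ?_ ?_ ?_ ?_
          · exact fun r hr s hs => h.disj r (Finset.mem_union_right _ hr) s
              (Finset.mem_union_right _ hs)
          · exact fun r hr => h.sub r (Finset.mem_union_right _ hr)
          · exact fun r hr => h.good r (Finset.mem_union_right _ hr)
          · have := h.big
            rw [pow_succ] at this
            omega
    intro U W F hc hd hs hg hb
    refine key _ U W F ∅ rfl ⟨hc, by simp, ?_, ?_, ?_, by simpa using hb⟩
    · simpa using hd
    · simpa using hs
    · simpa using hg

/-- If a `k`-uniform hypergraph (`k ≥ 1`) contains `2^k` pairwise disjoint edges, then Waiter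
has a winning strategy in the Waiter-Client game on it. -/
theorem wc_waiter_of_disjoint_edges (k : ℕ) (hk : 1 ≤ k) (V : Finset α)
    (E : Set (Finset α)) (hEV : ∀ e ∈ E, e ⊆ V) (hunif : ∀ e ∈ E, e.card = k)
    (D : Finset (Finset α)) (hDE : ↑D ⊆ E) (hD : D.card = 2 ^ k)
    (hdisj : ∀ d₁ ∈ D, ∀ d₂ ∈ D, d₁ ≠ d₂ → Disjoint d₁ d₂) :
    WCWaiterWins E V ∅ := by
  exact wins_of_family E k V ∅ D (fun r hr => hunif r (hDE hr)) hdisj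
    (fun r hr => hEV r (hDE hr)) (fun r hr => ⟨r, hDE hr, by simp⟩) hD.ge
end
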